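/- For every p : I → k there exists a k-algebra homomorphism ρ_p : A →ₐ[k] Module.End k V with ρ_p(X_i) = S_i and ρ_p(Y_i) = D_i for all i ∈ I; moreover such a homomorphism is unique. -/

import Mathlib

set_option synthInstance.maxHeartbeats 1000000
set_option maxHeartbeats 4000000

noncomputable section

open MvPolynomial

universe u v

variable (k : Type u) (I : Type v) [Field k]

/-- Multiplication by the variable `x i` on the polynomial algebra `B`. -/
def Xop (i : I) : Module.End k (MvPolynomial I k) :=
  LinearMap.mulLeft k (MvPolynomial.X i)

/-- The partial derivative `∂/∂x i` on the polynomial algebra `B`. -/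
def Yop (i : I) : Module.End k (MvPolynomial I k) :=
  (MvPolynomial.pderiv i).toLinearMap

/-- The infinite Weyl algebra `A`: the subalgebra of `Module.End k B` generated by
all `X i` and `Y i`. -/
def Weyl : Subalgebra k (Module.End k (MvPolynomial I k)) :=
  Algebra.adjoin k (Set.range (Xop k I) ∪ Set.range (Yop k I))

instance : Ring (Weyl k I) := inferInstance
instance : Algebra k (Weyl k I) := inferInstance

/-- `X i` as an element of the Weyl algebra. -/
def XA (i : I) : Weyl k I :=
  ⟨Xop k I i, Algebra.subset_adjoin (Set.mem_union_left _ ⟨i, rfl⟩)⟩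

/-- `Y i` as an element of the Weyl algebra. -/
def YA (i : I) : Weyl k I :=
  ⟨Yop k I i, Algebra.subset_adjoin (Set.mem_union_right _ ⟨i, rfl⟩)⟩

/-- `t i = X i * Y i` as an element of the Weyl algebra. -/
def tA (i : I) : Weyl k I := XA k I i * YA k I i

/-- The shift operator `S i : e_v ↦ e_{v + δ i}` on the free module `(I →₀ ℤ) →₀ k`. -/
def Sop (i : I) : Module.End k ((I →₀ ℤ) →₀ k) :=
  Finsupp.lmapDomain k k (fun v => v + Finsupp.single i 1)

/-- The twisted derivative operator `D i : e_v ↦ (p i + v i) • e_{v - δ i}`. -/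
def Dop (p : I → k) (i : I) : Module.End k ((I →₀ ℤ) →₀ k) :=
  Finsupp.lsum k fun v =>
    LinearMap.toSpanSingleton k ((I →₀ ℤ) →₀ k)
      ((p i + ((v i : ℤ) : k)) • Finsupp.single (v - Finsupp.single i 1) (1 : k))

theorem Sop_single (i : I) (v : I →₀ ℤ) (c : k) :
    Sop k I i (Finsupp.single v c) = Finsupp.single (v + Finsupp.single i 1) c := by
  simp [Sop]

theorem Dop_single (p : I → k) (i : I) (v : I →₀ ℤ) (c : k) :
    Dop k I p i (Finsupp.single v c) =
      Finsupp.single (v - Finsupp.single i 1) ((p i + ((v i : ℤ) : k)) * c) := by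
  rw [Dop, Finsupp.lsum_single, LinearMap.toSpanSingleton_apply, Finsupp.smul_single,
    Finsupp.smul_single, smul_eq_mul, smul_eq_mul, mul_one, mul_comm]

theorem Xop_monomial (i : I) (m : I →₀ ℕ) (c : k) :
    Xop k I i (monomial m c) = monomial (m + Finsupp.single i 1) c := by
  simp [Xop, X, monomial_mul, add_comm]

theorem Yop_monomial (i : I) (m : I →₀ ℕ) (c : k) :
    Yop k I i (monomial m c) = monomial (m - Finsupp.single i 1) (c * m i) :=
  pderiv_monomial

/-- The free algebra on symbols for the `X i` and the `Y i`. -/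
abbrev FreeXY : Type max u v := FreeAlgebra k (I ⊕ I)

/-- The action of the free algebra on polynomials. -/
def polyAction : FreeXY k I →ₐ[k] Module.End k (MvPolynomial I k) :=
  FreeAlgebra.lift k (Sum.elim (Xop k I) (Yop k I))

/-- The action of the free algebra on `(I →₀ ℤ) →₀ k` with parameter `p`. -/
def twistedAction (p : I → k) : FreeXY k I →ₐ[k] Module.End k ((I →₀ ℤ) →₀ k) :=
  FreeAlgebra.lift k (Sum.elim (Sop k I) (Dop k I p))

/-- The shift operator `S i` with polynomial coefficients. -/
def genericS (i : I) : Module.End k ((I →₀ ℤ) →₀ MvPolynomial I k) :=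
  Finsupp.lmapDomain (MvPolynomial I k) k (fun v => v + Finsupp.single i 1)

/-- The operator `D i` whose parameters are the polynomial variables. -/
def genericD (i : I) : Module.End k ((I →₀ ℤ) →₀ MvPolynomial I k) :=
  Finsupp.lsum k fun v =>
    Finsupp.lsingle (v - Finsupp.single i 1) ∘ₗ
      LinearMap.mulLeft k (X i + C ((v i : ℤ) : k))

/-- The action of the free algebra in which the parameters are polynomial variables. -/
def genericAction : FreeXY k I →ₐ[k] Module.End k ((I →₀ ℤ) →₀ MvPolynomial I k) :=
  FreeAlgebra.lift k (Sum.elim (genericS k I) (genericD k I))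

/-- Specialization of the polynomial parameters at `q`. -/
def specialization (q : I → k) : ((I →₀ ℤ) →₀ MvPolynomial I k) →ₗ[k] ((I →₀ ℤ) →₀ k) :=
  Finsupp.mapRange.linearMap (aeval q).toLinearMap

/-- The embedding `x ^ m ↦ e_{m + w}` of polynomials into `(I →₀ ℤ) →₀ k`. -/
def shiftEmbedding (w : I →₀ ℤ) : MvPolynomial I k →ₗ[k] ((I →₀ ℤ) →₀ k) :=
  (basisMonomials I k).constr k fun m =>
    Finsupp.single (m.mapRange Nat.cast Nat.cast_zero + w) 1

theorem specialization_single (q : I → k) (v : I →₀ ℤ) (f : MvPolynomial I k) :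
    specialization k I q (Finsupp.single v f) = Finsupp.single v (eval q f) := by
  simp [specialization, aeval_eq_eval]

theorem shiftEmbedding_monomial (w : I →₀ ℤ) (m : I →₀ ℕ) (c : k) :
    shiftEmbedding k I w (monomial m c) =
      Finsupp.single (m.mapRange Nat.cast Nat.cast_zero + w) c := by
  have h : monomial m c = c • basisMonomials I k m := by simp [smul_monomial]
  rw [h, map_smul, shiftEmbedding, Module.Basis.constr_basis]
  simp

/-- A linear map commuting with the generators commutes with the whole free algebra. -/
theorem FreeAlgebra.lift_intertwines {R T M N : Type*} [CommRing R] [AddCommGroup M] [Module R M]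
    [AddCommGroup N] [Module R N] (φ : T → Module.End R M) (ψ : T → Module.End R N)
    (f : M →ₗ[R] N) (h : ∀ t x, f (φ t x) = ψ t (f x)) (a : FreeAlgebra R T) (x : M) :
    f (FreeAlgebra.lift R φ a x) = FreeAlgebra.lift R ψ a (f x) := by
  induction a generalizing x with
  | grade0 r => simp [Module.algebraMap_end_apply]
  | grade1 t => simp [h]
  | mul a b ha hb => simp [ha, hb]
  | add a b ha hb => simp [ha, hb]

theorem specialization_genericAction (q : I → k) (a : FreeXY k I)
    (z : (I →₀ ℤ) →₀ MvPolynomial I k) :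
    specialization k I q (genericAction k I a z) = twistedAction k I q a (specialization k I q z) := by
  refine FreeAlgebra.lift_intertwines _ _ _ ?_ a z
  intro t z
  induction z using Finsupp.induction_linear with
  | zero => simp
  | add y z hy hz => simp only [map_add, hy, hz]
  | single v f =>
    rcases t with i | i
    · simp [genericS, specialization_single, Sop_single]
    · simp only [Sum.elim_inr, genericD, Finsupp.lsum_single, LinearMap.comp_apply,
        LinearMap.mulLeft_apply, Finsupp.lsingle_apply, specialization_single, Dop_single]
      simp only [map_mul, map_add, eval_X, eval_C]

theorem shiftEmbedding_polyAction (q : I → k) (w : I →₀ ℤ) (hq : ∀ i, q i + ((w i : ℤ) : k) = 0)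
    (a : FreeXY k I) (z : MvPolynomial I k) :
    shiftEmbedding k I w (polyAction k I a z) =
      twistedAction k I q a (shiftEmbedding k I w z) := by
  refine FreeAlgebra.lift_intertwines _ _ _ ?_ a z
  intro t z
  induction z using MvPolynomial.induction_on' with
  | add y z hy hz => simp only [map_add, hy, hz]
  | monomial m c =>
    rcases t with i | i
    · simp only [Sum.elim_inl, Xop_monomial, shiftEmbedding_monomial, Sop_single]
      congr 1
      ext j
      by_cases hj : j = i
      · subst hj
        simp
        ring
      · simp [Ne.symm hj]
    · simp only [Sum.elim_inr, Yop_monomial, shiftEmbedding_monomial, Dop_single]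
      have hcoef : q i + ((((m.mapRange Nat.cast Nat.cast_zero : I →₀ ℤ) + w) i : ℤ) : k) = m i := by
        have := hq i
        simp
        linear_combination this
      rw [hcoef, mul_comm]
      rcases Nat.eq_zero_or_pos (m i) with hi | hi
      · simp [hi]
      · congr 1
        ext j
        by_cases hj : j = i
        · subst hj
          simp
          omega
        · simp [Ne.symm hj]

theorem twistedAction_eq_zero [CharZero k] (a : FreeXY k I) (ha : polyAction k I a = 0)
    (p : I → k) : twistedAction k I p a = 0 := by
  have hgen (v : I →₀ ℤ) : genericAction k I a (Finsupp.single v 1) = 0 := by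
    ext1 u
    set c := genericAction k I a (Finsupp.single v 1) u with hc
    have hspec (q : I → k) : eval q c = twistedAction k I q a (Finsupp.single v 1) u := by
      have := specialization_genericAction k I q a (Finsupp.single v 1)
      rw [specialization_single, map_one] at this
      rw [← this, hc]
      simp [specialization, aeval_eq_eval]
    refine funext_set (fun i => Set.range fun n : ℕ => (n : k) - ((v i : ℤ) : k))
      (fun i => Set.infinite_range_of_injective fun m n h => by simpa using h) fun x hx => ?_
    choose n hn using fun i => hx i trivial
    classical
    let m : I →₀ ℕ :=
      Finsupp.onFinset c.vars (fun i => if i ∈ c.vars then n i else 0) (by simp; tauto)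
    let w : I →₀ ℤ := v - m.mapRange Nat.cast Nat.cast_zero
    let q : I → k := fun i => -((w i : ℤ) : k)
    have hxq : eval x c = eval q c := by
      refine eval₂Hom_congr' rfl (fun i hi _ => ?_) rfl
      simp [q, w, m, hi, ← hn]
    have h := shiftEmbedding_polyAction k I q w (by simp [q]) a (monomial m 1)
    rw [ha, shiftEmbedding_monomial] at h
    simp only [LinearMap.zero_apply, map_zero] at h
    rw [show m.mapRange Nat.cast Nat.cast_zero + w = v by simp [w]] at h
    simp [hxq, hspec, ← h]
  refine Finsupp.lhom_ext fun v c => ?_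
  have h := specialization_genericAction k I p a (Finsupp.single v 1)
  rw [hgen, map_zero, specialization_single, map_one] at h
  rw [← mul_one c, ← smul_eq_mul, ← Finsupp.smul_single, map_smul, ← h]
  simp

/-- The canonical map from the free algebra onto the Weyl algebra. -/
def toWeyl : FreeXY k I →ₐ[k] Weyl k I :=
  FreeAlgebra.lift k (Sum.elim (XA k I) (YA k I))

theorem coe_toWeyl (a : FreeXY k I) :
    (toWeyl k I a : Module.End k (MvPolynomial I k)) = polyAction k I a := by
  have h : (Weyl k I).val.comp (toWeyl k I) = polyAction k I := by
    refine FreeAlgebra.hom_ext (funext fun t => ?_)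
    rcases t with i | i <;> simp [toWeyl, polyAction, XA, YA]
  exact DFunLike.congr_fun h a

theorem toWeyl_surjective : Function.Surjective (toWeyl k I) := by
  rintro ⟨x, hx⟩
  rw [Weyl, ← Set.Sum.elim_range, Algebra.adjoin_range_eq_range_freeAlgebra_lift] at hx
  obtain ⟨a, rfl⟩ := hx
  exact ⟨a, Subtype.ext (coe_toWeyl k I a)⟩

/-- An algebra homomorphism constant on the fibres of a surjection factors through it. -/
theorem AlgHom.exists_comp_eq_of_surjective {R A B C : Type*} [CommSemiring R] [Semiring A]
    [Semiring B] [Semiring C] [Algebra R A] [Algebra R B] [Algebra R C] (g : A →ₐ[R] B)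
    (hg : Function.Surjective g) (φ : A →ₐ[R] C) (h : ∀ a b, g a = g b → φ a = φ b) :
    ∃ ρ : B →ₐ[R] C, ρ.comp g = φ := by
  choose s hs using hg
  refine ⟨AlgHom.ofLinearMap
    { toFun := fun b => φ (s b)
      map_add' := fun x y => by rw [← map_add]; exact h _ _ (by simp [hs])
      map_smul' := fun r x => by
        rw [RingHom.id_apply, ← map_smul]; exact h _ _ (by simp [hs]) }
    ?_ ?_, ?_⟩
  · exact (h _ 1 (by simp [hs])).trans (map_one φ)
  · intro x y
    exact (h _ (s x * s y) (by simp [hs])).trans (map_mul φ _ _)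
  · ext a
    exact h _ _ (hs _)

/-- There is a unique `k`-algebra homomorphism `ρ_p` from the Weyl algebra
to `Module.End k V` with `ρ_p (X i) = S i` and `ρ_p (Y i) = D i` for all `i`. -/
theorem exists_unique_rho [IsAlgClosed k] [CharZero k] [Infinite I] (p : I → k) :
    ∃! ρ : Weyl k I →ₐ[k] Module.End k ((I →₀ ℤ) →₀ k),
      (∀ i, ρ (XA k I i) = Sop k I i) ∧ (∀ i, ρ (YA k I i) = Dop k I p i) := by
  have hgen (ρ : Weyl k I →ₐ[k] Module.End k ((I →₀ ℤ) →₀ k)) :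
      ρ.comp (toWeyl k I) = twistedAction k I p ↔
        (∀ i, ρ (XA k I i) = Sop k I i) ∧ (∀ i, ρ (YA k I i) = Dop k I p i) := by
    rw [FreeAlgebra.hom_ext_iff, funext_iff, Sum.forall]
    simp [toWeyl, twistedAction]
  have hker (a b : FreeXY k I) (hab : toWeyl k I a = toWeyl k I b) :
      twistedAction k I p a = twistedAction k I p b := by
    have h := twistedAction_eq_zero k I (a - b)
      (by rw [map_sub, ← coe_toWeyl, ← coe_toWeyl, hab, sub_self]) p
    rwa [map_sub, sub_eq_zero] at h
  obtain ⟨ρ, hρ⟩ := AlgHom.exists_comp_eq_of_surjective (toWeyl k I) (toWeyl_surjective k I)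
    (twistedAction k I p) hker
  refine ⟨ρ, (hgen ρ).1 hρ, fun σ hσ => ?_⟩
  exact (AlgHom.cancel_right (toWeyl_surjective k I)).1 (((hgen σ).2 hσ).trans hρ.symm)
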